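/- arXiv:1003.5160 — 4 statements merged into one kernel-verified Lean document; each statement's English description precedes it below -/
import Mathlib

section
/- Let A be an n×n real matrix (n ≥ 3) and let i, j, k be three distinct indices in {1,…,n}. Let ℵ denote the list of the indices {1,…,n}\{i,j,k} taken in increasing order, and for ordered index lists α, β of equal length write A[α;β] for the determinant of the submatrix of A whose rows are taken in the order given by α and whose columns in the order given by β. Then A[(i,ℵ);(i,ℵ)]·ã_{k,i} + A[(j,ℵ);(i,ℵ)]·ã_{k,j} + A[(k,ℵ);(i,ℵ)]·ã_{k,k} = 0, where ã_{r,s} denotes the (r,s) entry of the adjugate (classical adjoint) of A. -/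
open Matrix

/-- The list of the indices `{1,…,n} \ {i,j,k}` taken in increasing order,
as a strictly monotone enumeration of the complement of `{i,j,k}`. -/
def alephList {n : ℕ} (i j k : Fin n) :
    Fin (({i, j, k}ᶜ : Finset (Fin n)).card) → Fin n :=
  (({i, j, k}ᶜ : Finset (Fin n)).orderEmbOfFin rfl)

/-- The relations `∑ r, ã k r * A r c = 0` for `c ≠ k`, expanded along a varying first row:
minors whose columns avoid `k` are annihilated by row `k` of the adjugate. -/
theorem sum_det_submatrix_cons_mul_adjugate {ι R : Type*} [Fintype ι] [DecidableEq ι]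
    [CommRing R] {m : ℕ} (A : Matrix ι ι R) (k : ι) (e : Fin m → ι) (c : Fin (m + 1) → ι)
    (hc : ∀ l, c l ≠ k) :
    ∑ r, (A.submatrix (Fin.cons r e : Fin (m + 1) → ι) c).det * A.adjugate k r = 0 := by
  have hcol (l : Fin (m + 1)) : ∑ r, A.adjugate k r * A r (c l) = 0 := by
    rw [← mul_apply, adjugate_mul, Matrix.smul_apply, one_apply_ne (hc l).symm, smul_zero]
  simp only [det_succ_row_zero, Finset.sum_mul]
  rw [Finset.sum_comm]
  refine Finset.sum_eq_zero fun l _ => ?_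
  calc
    _ = ∑ r, (-1) ^ (l : ℕ) * (A.submatrix e (c ∘ l.succAbove)).det *
          (A.adjugate k r * A r (c l)) := by
      refine Finset.sum_congr rfl fun r _ => ?_
      have hminor : (A.submatrix (Fin.cons r e : Fin (m + 1) → ι) c).submatrix
          Fin.succ l.succAbove = A.submatrix e (c ∘ l.succAbove) := by
        ext; simp
      rw [hminor, submatrix_apply, Fin.cons_zero]
      ring
    _ = 0 := by rw [← Finset.mul_sum, hcol, mul_zero]

theorem range_alephList {n : ℕ} (i j k : Fin n) :
    Set.range (alephList i j k) = ({i, j, k}ᶜ : Finset (Fin n)) :=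
  Finset.range_orderEmbOfFin _ rfl

/-- Lemma 2.2: for distinct indices `i, j, k`,
`A[i,ℵ;i,ℵ]·ã_{k,i} + A[j,ℵ;i,ℵ]·ã_{k,j} + A[k,ℵ;i,ℵ]·ã_{k,k} = 0`,
where `ℵ` lists `{1,…,n}\{i,j,k}` in increasing order and `ã` is the adjugate of `A`. -/
theorem adjugate_linear_relation {n : ℕ} (hn : 3 ≤ n)
    (A : Matrix (Fin n) (Fin n) ℝ) (i j k : Fin n)
    (hij : i ≠ j) (hik : i ≠ k) (hjk : j ≠ k) :
    (A.submatrix (Fin.cons i (alephList i j k)) (Fin.cons i (alephList i j k))).det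
        * A.adjugate k i
      + (A.submatrix (Fin.cons j (alephList i j k)) (Fin.cons i (alephList i j k))).det
        * A.adjugate k j
      + (A.submatrix (Fin.cons k (alephList i j k)) (Fin.cons i (alephList i j k))).det
        * A.adjugate k k = 0 := by
  have hsum := sum_det_submatrix_cons_mul_adjugate A k (alephList i j k)
    (Fin.cons i (alephList i j k)) (by
      intro l
      refine Fin.cases (by simpa using hik) (fun t => ?_) l
      have ht : alephList i j k t ∈ Set.range (alephList i j k) := ⟨t, rfl⟩
      rw [range_alephList] at ht
      simp only [Finset.coe_compl, Set.mem_compl_iff, Finset.mem_coe, Finset.mem_insert,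
        Finset.mem_singleton, not_or] at ht
      simpa using ht.2.2)
  rw [← Finset.sum_subset (Finset.subset_univ {i, j, k}),
    Finset.sum_insert (by simp [hij, hik]), Finset.sum_pair hjk, ← add_assoc] at hsum
  · exact hsum
  · intro r _ hr
    obtain ⟨t, ht⟩ : r ∈ Set.range (alephList i j k) := by
      rw [range_alephList]
      rwa [Finset.coe_compl, Set.mem_compl_iff, Finset.mem_coe]
    rw [det_zero_of_row_eq (Fin.succ_ne_zero t), zero_mul]
    ext l
    simp [ht]
end

section
/- Let T be a tree on vertices 1,…,n and let A be an n×n real T-TP matrix such that det A > 0 and, for every pendant vertex p of T, the principal submatrix of A obtained by deleting row p and column p is a P-matrix. Let σ : {1,…,n} → {+1,−1} be a sign function with σ_u = −σ_v for every edge {u,v} of T. Then (up to replacing σ by −σ) every entry of the adjugate ã of A satisfies sign(ã_{i,j}) = σ_i · σ_j for all 1 ≤ i, j ≤ n; equivalently, the matrix D·ã·D has all entries positive, where D = diag(σ_1,…,σ_n). -/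
open Matrix

/-- Every minor (rows and columns taken in increasing order) is positive. -/
def IsTotallyPositive {m : ℕ} (M : Matrix (Fin m) (Fin m) ℝ) : Prop :=
  ∀ (k : ℕ) (f g : Fin k → Fin m), StrictMono f → StrictMono g →
    0 < (M.submatrix f g).det

/-- `A` is T-TP: for every (induced) path of `T`, the submatrix of `A` whose rows and
columns are indexed by the vertices of the path, in path order, is totally positive. -/
def IsTTP {n : ℕ} (T : SimpleGraph (Fin n)) (A : Matrix (Fin n) (Fin n) ℝ) : Prop :=
  ∀ (u v : Fin n) (w : T.Walk u v), w.IsPath →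
    IsTotallyPositive (Matrix.of fun s t : Fin w.support.length =>
      A (w.support.get s) (w.support.get t))

/-- All principal minors are positive. -/
def IsPMatrix {m : Type*} [Fintype m] [DecidableEq m] (M : Matrix m m ℝ) : Prop :=
  ∀ s : Finset m, 0 < (M.submatrix (fun i : s => (i : m)) (fun i : s => (i : m))).det

/-- A pendant vertex: a vertex of degree one. -/
def Pendant {n : ℕ} (T : SimpleGraph (Fin n)) (p : Fin n) : Prop :=
  ∃! u : Fin n, T.Adj p u

/-- The principal submatrix obtained by deleting row `p` and column `p`. -/
def deleteVertex {n : ℕ} (A : Matrix (Fin n) (Fin n) ℝ) (p : Fin n) :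
    Matrix {i : Fin n // i ≠ p} {i : Fin n // i ≠ p} ℝ :=
  A.submatrix (fun i => (i : Fin n)) (fun i => (i : Fin n))

/-- `σ` is a ±1 sign function alternating along the edges of `T`. -/
def IsSigning {n : ℕ} (T : SimpleGraph (Fin n)) (σ : Fin n → ℝ) : Prop :=
  (∀ i, σ i = 1 ∨ σ i = -1) ∧ ∀ u v : Fin n, T.Adj u v → σ u = -σ v

section SignAlgebra

variable {V : Type*} {C : V → V → ℝ} {P : V → Prop}

lemma pos_of_crossPos (hd : ∀ p, P p → 0 < C p p)
    (h : ∀ p, P p → ∀ i, i ≠ p → ∀ k, k ≠ p → C i p * C p k < C i k * C p p)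
    {p q i : V} (hp : P p) (hq : P q) (hpq : p ≠ q) (hip : i ≠ p) (hiq : i ≠ q)
    (hqp : 0 < C q p) : 0 < C i p := by
  by_contra! hx
  have hpp := hd p hp
  have hqq := hd q hq
  have h₁ := h q hq i hiq p hpq
  have h₂ := h p hp i hip q hpq.symm
  have h₃ := h q hq p hpq p hpq
  have h₄ := mul_lt_mul_of_pos_right h₁ hpp
  have h₅ := mul_lt_mul_of_pos_right h₂ hqp
  have h₆ := mul_le_mul_of_nonpos_left h₃.le hx
  linarith

lemma pos_of_crossPos' (hd : ∀ p, P p → 0 < C p p)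
    (h : ∀ p, P p → ∀ i, i ≠ p → ∀ k, k ≠ p → C i p * C p k < C i k * C p p)
    {p q i : V} (hp : P p) (hq : P q) (hpq : p ≠ q) (hip : i ≠ p) (hiq : i ≠ q)
    (hqp : 0 < C p q) : 0 < C p i :=
  pos_of_crossPos (C := fun x y => C y x) hd
    (fun p hp i hi k hk => by simpa only [mul_comm] using h p hp k hk i hi) hp hq hpq hip hiq hqp

/-- If the Schur complements of an array with respect to three of its diagonal entries are
entrywise positive, and those diagonal entries are positive, then so is the whole array. -/
lemma pos_of_three (hd : ∀ p, P p → 0 < C p p)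
    (h : ∀ p, P p → ∀ i, i ≠ p → ∀ k, k ≠ p → C i p * C p k < C i k * C p p)
    {a b c : V} (ha : P a) (hb : P b) (hc : P c) (hab : a ≠ b) (hac : a ≠ c) (hbc : b ≠ c)
    (i j : V) : 0 < C i j := by
  have key : ∀ {a b c}, P a → P b → P c → a ≠ b → a ≠ c → b ≠ c → 0 < C a b := by
    intro a b c ha hb hc hab hac hbc
    by_contra! hn
    have h₁ := h c hc a hac b hbc
    rcases lt_or_ge 0 (C c b) with h₂ | h₂
    · exact hn.not_gt (pos_of_crossPos hd h hb hc hbc hab hac h₂)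
    rcases lt_or_ge 0 (C a c) with h₃ | h₃
    · exact hn.not_gt (pos_of_crossPos' hd h ha hc hac hab.symm hbc h₃)
    exact absurd (mul_nonneg_of_nonpos_of_nonpos h₃ h₂)
      (h₁.trans_le (mul_nonpos_of_nonpos_of_nonneg hn (hd c hc).le)).not_ge
  have hC_ab := key ha hb hc hab hac hbc
  have hC_ba := key hb ha hc hab.symm hbc hac
  have col : ∀ i, 0 < C i a := by
    intro i
    rcases eq_or_ne i a with rfl | hia
    · exact hd _ ha
    rcases eq_or_ne i b with rfl | hib
    · exact hC_ba
    exact pos_of_crossPos hd h ha hb hab hia hib hC_ba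
  have row : ∀ i, 0 < C a i := by
    intro i
    rcases eq_or_ne i a with rfl | hia
    · exact hd _ ha
    rcases eq_or_ne i b with rfl | hib
    · exact hC_ab
    exact pos_of_crossPos' hd h ha hb hab hia hib hC_ab
  rcases eq_or_ne i a with rfl | hia
  · exact row j
  rcases eq_or_ne j a with rfl | hja
  · exact col i
  exact pos_of_mul_pos_left ((mul_pos (col i) (row j)).trans (h a ha i hia j hja)) (hd a ha).le

end SignAlgebra

section Minors

variable {V : Type*} [Fintype V] [DecidableEq V]

lemma adjugate_self_eq_det_minor (A : Matrix V V ℝ) (p : V) :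
    A.adjugate p p =
      (A.submatrix (Subtype.val : {i // i ≠ p} → V) (Subtype.val : {i // i ≠ p} → V)).det := by
  rw [adjugate_apply, twoBlockTriangular_det' _ (fun i => i = p)]
  · have h₁ : (toSquareBlockProp (A.updateRow p (Pi.single p 1)) fun i => i = p) = 1 := by
      ext ⟨i, rfl⟩ ⟨j, rfl⟩
      simp [toSquareBlockProp, toBlock]
    have h₂ : (toSquareBlockProp (A.updateRow p (Pi.single p 1)) fun i => ¬ i = p) =
        A.submatrix (Subtype.val : {i // i ≠ p} → V) (Subtype.val : {i // i ≠ p} → V) := by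
      ext i j
      simp [toSquareBlockProp, toBlock, i.2]
    rw [h₁, h₂]
    convert one_mul _ using 2
    convert! det_one
  · rintro i rfl j hj
    simp [hj]

/-- The `2 × 2` minors of the adjugate through the diagonal entry `(p, p)` are, up to the factor
`det A`, the entries of the adjugate of the principal submatrix without `p`. -/
lemma adjugate_cross_eq (A : Matrix V V ℝ) (p : V)
    (hB : (A.submatrix (Subtype.val : {i // i ≠ p} → V) Subtype.val).det ≠ 0)
    (i k : {i // i ≠ p}) :
    A.adjugate i k * A.adjugate p p - A.adjugate i p * A.adjugate p k =
      A.det * (A.submatrix (Subtype.val : {i // i ≠ p} → V) Subtype.val).adjugate i k := by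
  set B := A.submatrix (Subtype.val : {i // i ≠ p} → V) Subtype.val with hBdef
  let S : Matrix {i // i ≠ p} {i // i ≠ p} ℝ := of fun i k =>
    A.adjugate i k * A.adjugate p p - A.adjugate i p * A.adjugate p k
  have hBS : B * S = (A.det * B.det) • (1 : Matrix {i // i ≠ p} {i // i ≠ p} ℝ) := by
    ext i k
    have hmul : ∀ k, ∑ j, A i j * A.adjugate j k = A.det * (1 : Matrix V V ℝ) i k := by
      intro k
      simpa [Matrix.mul_apply] using congrFun (congrFun A.mul_adjugate i) k
    have hsum : ∑ j, A i j * (A.adjugate j k * A.adjugate p p - A.adjugate j p * A.adjugate p k) =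
        A.det * (1 : Matrix V V ℝ) i k * A.adjugate p p := by
      have : ∀ j, A i j * (A.adjugate j k * A.adjugate p p - A.adjugate j p * A.adjugate p k) =
          A i j * A.adjugate j k * A.adjugate p p - A i j * A.adjugate j p * A.adjugate p k :=
        fun j => by ring
      simp_rw [this, Finset.sum_sub_distrib, ← Finset.sum_mul, hmul]
      simp [Matrix.one_apply_ne i.2]
    rw [← Fintype.sum_subtype_add_sum_subtype (fun j => j ≠ p)] at hsum
    have hzero : ∑ j : {j // ¬ j ≠ p}, A i j *
        (A.adjugate j k * A.adjugate p p - A.adjugate j p * A.adjugate p k) = 0 := by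
      refine Finset.sum_eq_zero fun j _ => ?_
      rw [not_not.1 j.2]
      ring
    rw [hzero, add_zero, adjugate_self_eq_det_minor, ← hBdef] at hsum
    simp only [Matrix.mul_apply, S, of_apply, hBdef, submatrix_apply, Matrix.smul_apply, smul_eq_mul]
    rw [adjugate_self_eq_det_minor, ← hBdef, hsum, Matrix.one_apply, Matrix.one_apply]
    simp only [Subtype.ext_iff]
    ring
  have hS : S = A.det • B.adjugate := by
    have h := congrArg (B.adjugate * ·) hBS
    simp only [← Matrix.mul_assoc, adjugate_mul, Matrix.mul_smul, Matrix.mul_one,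
      Matrix.smul_mul, Matrix.one_mul] at h
    rw [mul_comm, ← smul_smul] at h
    exact smul_right_injective _ hB h
  simpa [S] using congrFun (congrFun hS i) k

lemma IsPMatrix.submatrix {m : Type*} [Fintype m] [DecidableEq m] {M : Matrix V V ℝ}
    (hM : IsPMatrix M) (f : m ↪ V) : IsPMatrix (M.submatrix f f) := by
  intro s
  let e : s ≃ s.map f := Equiv.ofBijective
    (fun i => ⟨f i, Finset.mem_map_of_mem f i.2⟩)
    ⟨fun i j h => Subtype.ext (f.injective (congrArg Subtype.val h)), by
      rintro ⟨x, hx⟩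
      obtain ⟨y, hy, rfl⟩ := Finset.mem_map.1 hx
      exact ⟨⟨y, hy⟩, rfl⟩⟩
  have h := hM (s.map f)
  rw [← det_submatrix_equiv_self e] at h
  exact h

lemma IsPMatrix.det_pos {M : Matrix V V ℝ} (hM : IsPMatrix M) : 0 < M.det := by
  have h := hM Finset.univ
  rw [← det_submatrix_equiv_self (Equiv.subtypeUnivEquiv Finset.mem_univ).symm] at h
  exact h

lemma IsTotallyPositive.adjugate_pos {m : ℕ} {M : Matrix (Fin m) (Fin m) ℝ}
    (hM : IsTotallyPositive M) (i j : Fin m) :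
    0 < (-1) ^ (i : ℕ) * M.adjugate i j * (-1) ^ (j : ℕ) := by
  cases m with
  | zero => exact i.elim0
  | succ m =>
    rw [adjugate_fin_succ_eq_det_submatrix, pow_add]
    have h := hM m _ _ (Fin.strictMono_succAbove j) (Fin.strictMono_succAbove i)
    have hi : ((-1 : ℝ) ^ (i : ℕ)) * (-1) ^ (i : ℕ) = 1 := by
      rw [← mul_pow]; simp
    have hj : ((-1 : ℝ) ^ (j : ℕ)) * (-1) ^ (j : ℕ) = 1 := by
      rw [← mul_pow]; simp
    calc (0 : ℝ) < ((-1) ^ (i : ℕ) * (-1) ^ (i : ℕ)) * ((-1) ^ (j : ℕ) * (-1) ^ (j : ℕ)) *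
          (M.submatrix j.succAbove i.succAbove).det := by rwa [hi, hj, one_mul, one_mul]
      _ = _ := by ring

end Minors

section Trees

variable {V : Type*} {T : SimpleGraph V}

open SimpleGraph

lemma exists_pendant_of_mem_path [Fintype V] (hT : T.IsTree) {u x : V} (hx : x ≠ u) :
    ∃ (y : V) (w : T.Walk u y), y ≠ u ∧ (∃! z, T.Adj y z) ∧ w.IsPath ∧ x ∈ w.support := by
  suffices h : ∀ (d : ℕ) (y : V) (w : T.Walk u y), w.IsPath → x ∈ w.support →
      Fintype.card V = w.length + d →
      ∃ (y : V) (w : T.Walk u y), y ≠ u ∧ (∃! z, T.Adj y z) ∧ w.IsPath ∧ x ∈ w.support by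
    obtain ⟨w, hw⟩ := hT.connected.exists_isPath u x
    exact h _ x w hw w.end_mem_support (Nat.add_sub_of_le hw.length_lt.le).symm
  intro d
  induction d with
  | zero =>
    intro y w hw _ hd
    have := hw.length_lt
    omega
  | succ d ih =>
    intro y w hw hxw hd
    have hnil : ¬ w.Nil := by
      intro hn
      have := hn.eq
      subst this
      rw [Walk.eq_nil_iff_nil.2 hn] at hxw
      simp [hx] at hxw
    have hadj := (w.adj_penultimate hnil).symm
    by_cases hy : ∃! z, T.Adj y z
    · exact ⟨y, w, fun h => hnil (hw.nil_iff_eq.2 h.symm), hy, hw, hxw⟩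
    · obtain ⟨z, hz, hne⟩ : ∃ z, T.Adj y z ∧ z ≠ w.penultimate := by
        by_contra! hcon
        exact hy ⟨_, hadj, hcon⟩
      have hzw : z ∉ w.support := fun hmem =>
        hne (hT.isAcyclic.eq_penultimate_of_adj_end hw hz hmem)
      refine ih z (w.concat hz) (hw.concat hzw hz) ?_ ?_
      · rw [Walk.support_concat]
        simp [hxw]
      · rw [Walk.length_concat]
        omega

/-- A finite tree is a path or has three leaves. -/
lemma hamiltonian_path_or_three_pendants [Fintype V] (hT : T.IsTree) :
    (∃ (u v : V) (w : T.Walk u v), w.IsPath ∧ ∀ x, x ∈ w.support) ∨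
    ∃ a b c : V, (∃! z, T.Adj a z) ∧ (∃! z, T.Adj b z) ∧ (∃! z, T.Adj c z) ∧
      a ≠ b ∧ a ≠ c ∧ b ≠ c := by
  obtain ⟨r⟩ := hT.connected.nonempty
  by_cases hr : ∃ x, x ≠ r
  swap
  · push Not at hr
    exact .inl ⟨r, r, .nil, .nil, fun x => by simp [hr x]⟩
  obtain ⟨x, hx⟩ := hr
  obtain ⟨u, -, hur, hu, -, -⟩ := exists_pendant_of_mem_path hT hx
  obtain ⟨v, w, hvu, hv, hw, -⟩ := exists_pendant_of_mem_path hT hur.symm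
  by_cases hc : ∃ c, c ≠ u ∧ c ≠ v ∧ ∃! z, T.Adj c z
  · obtain ⟨c, hcu, hcv, hc⟩ := hc
    exact .inr ⟨u, v, c, hu, hv, hc, hvu.symm, hcu.symm, hcv.symm⟩
  · refine .inl ⟨u, v, w, hw, fun x => ?_⟩
    rcases eq_or_ne x u with rfl | hxu
    · exact w.start_mem_support
    obtain ⟨y, w', hyu, hy, hw', hx⟩ := exists_pendant_of_mem_path hT hxu
    have hyv : y = v := by
      by_contra hyv
      exact hc ⟨y, hyu, hyv, hy⟩
    subst hyv
    rwa [(hT.existsUnique_path _ _).unique hw hw']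

lemma isTree_comap_ne (hT : T.IsTree) {p : V} (hp : ∃! z, T.Adj p z) :
    (T.comap (Subtype.val : {i // i ≠ p} → V)).IsTree := by
  classical
  obtain ⟨z, hz, huniq⟩ := hp
  have : Fintype (T.neighborSet p) :=
    ⟨{⟨z, hz⟩}, fun y => by simpa [Subtype.ext_iff] using huniq y y.2⟩
  exact ⟨hT.connected.induce_compl_singleton_of_degree_eq_one
    (degree_eq_one_iff_existsUnique_adj.2 ⟨z, hz, huniq⟩), hT.isAcyclic.induce {p}ᶜ⟩

lemma sign_getVert {σ : V → ℝ} (hσ : ∀ u v, T.Adj u v → σ u = -σ v) {u v : V} (w : T.Walk u v) :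
    ∀ s ≤ w.length, σ (w.getVert s) = (-1) ^ s * σ u := by
  intro s
  induction s with
  | zero => simp
  | succ s ih =>
    intro hs
    have h := hσ _ _ (w.adj_getVert_succ hs)
    rw [ih (by omega)] at h
    rw [pow_succ]
    linarith

end Trees

/-- Total positivity of the path submatrices restricts to induced subgraphs. -/
lemma isTotallyPositive_path_comap {V W : Type*} {T : SimpleGraph V} {A : Matrix V V ℝ}
    (h : ∀ (u v : V) (w : T.Walk u v), w.IsPath → IsTotallyPositive
      (of fun s t : Fin w.support.length => A (w.support.get s) (w.support.get t)))
    (f : W ↪ V) (u v : W) (w : (T.comap f).Walk u v) (hw : w.IsPath) : IsTotallyPositive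
      (of fun s t : Fin w.support.length => A.submatrix f f (w.support.get s) (w.support.get t)) := by
  let φ : T.comap f →g T := ⟨f, fun h => h⟩
  have hφ : Function.Injective φ := f.injective
  have hlen : w.support.length = (w.map φ).support.length := by
    simp [SimpleGraph.Walk.support_map]
  intro k r c hr hc
  have hpos := h _ _ (w.map φ) (hw.map hφ) k (Fin.cast hlen ∘ r) (Fin.cast hlen ∘ c)
    (fun _ _ hlt => hr hlt) (fun _ _ hlt => hc hlt)
  convert hpos using 2
  ext i j
  simp only [submatrix_apply, of_apply, Function.comp_apply, List.get_eq_getElem, Fin.val_cast,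
    SimpleGraph.Walk.support_map, List.getElem_map]
  rfl

lemma adjugate_signs_of_hamiltonian {V : Type*} [Fintype V] [DecidableEq V] {T : SimpleGraph V}
    {A : Matrix V V ℝ} {σ : V → ℝ} (hσ₁ : ∀ i, σ i = 1 ∨ σ i = -1)
    (hσ₂ : ∀ u v, T.Adj u v → σ u = -σ v) {u v : V} {w : T.Walk u v} (hw : w.IsPath)
    (hTP : IsTotallyPositive
      (of fun s t : Fin w.support.length => A (w.support.get s) (w.support.get t)))
    (hall : ∀ x, x ∈ w.support) (i j : V) : 0 < σ i * A.adjugate i j * σ j := by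
  let e := hw.support_nodup.getEquivOfForallMemList w.support hall
  have he : ∀ s, σ (e s) = (-1) ^ (s : ℕ) * σ u := by
    intro s
    have hs : (s : ℕ) ≤ w.length := by
      have hlt := s.2
      have hlen := w.length_support
      omega
    rw [← sign_getVert hσ₂ w s hs, w.getVert_eq_support_getElem hs]
    rfl
  obtain ⟨s, rfl⟩ := e.surjective i
  obtain ⟨t, rfl⟩ := e.surjective j
  have h := hTP.adjugate_pos s t
  change 0 < _ * (A.submatrix e e).adjugate s t * _ at h
  rw [adjugate_submatrix_equiv_self, submatrix_apply] at h
  have hu : σ u * σ u = 1 := by rcases hσ₁ u with h | h <;> simp [h]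
  rw [he, he]
  calc (0 : ℝ) < (-1) ^ (s : ℕ) * A.adjugate (e s) (e t) * (-1) ^ (t : ℕ) * (σ u * σ u) := by
        rwa [hu, mul_one]
    _ = _ := by ring

lemma adjugate_signs {V : Type} [Fintype V] [DecidableEq V] {T : SimpleGraph V} (hT : T.IsTree)
    {A : Matrix V V ℝ} (hTTP : ∀ (u v : V) (w : T.Walk u v), w.IsPath → IsTotallyPositive
      (of fun s t : Fin w.support.length => A (w.support.get s) (w.support.get t)))
    (hdet : 0 < A.det)
    (hP : ∀ p, (∃! u, T.Adj p u) →
      IsPMatrix (A.submatrix (Subtype.val : {i // i ≠ p} → V) Subtype.val))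
    {σ : V → ℝ} (hσ₁ : ∀ i, σ i = 1 ∨ σ i = -1) (hσ₂ : ∀ u v, T.Adj u v → σ u = -σ v)
    (i j : V) : 0 < σ i * A.adjugate i j * σ j := by
  induction hn : Fintype.card V generalizing V with
  | zero => exact (Fintype.card_eq_zero_iff.1 hn).elim i
  | succ n ih =>
    rcases hamiltonian_path_or_three_pendants hT with
      ⟨u, v, w, hw, hall⟩ | ⟨a, b, c, ha, hb, hc, hab, hac, hbc⟩
    · exact adjugate_signs_of_hamiltonian hσ₁ hσ₂ hw (hTTP u v w hw) hall i j
    have hσσ : ∀ i, σ i * σ i = 1 := fun i => by rcases hσ₁ i with h | h <;> simp [h]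
    refine pos_of_three (C := fun i j => σ i * A.adjugate i j * σ j)
      (P := fun p => ∃! z, T.Adj p z) (fun p hp => ?_) (fun p hp i hip k hkp => ?_)
      ha hb hc hab hac hbc i j
    · have h := (hP p hp).det_pos
      rw [← adjugate_self_eq_det_minor] at h
      calc (0 : ℝ) < A.adjugate p p * (σ p * σ p) := by rwa [hσσ, mul_one]
        _ = _ := by ring
    · have hsub := ih (V := {i // i ≠ p}) (isTree_comap_ne hT hp)
        (isTotallyPositive_path_comap hTTP (.subtype _)) (hP p hp).det_pos
        (fun q _ => (hP p hp).submatrix (.subtype _)) (σ := fun i => σ i) (fun i => hσ₁ i)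
        (fun u v huv => hσ₂ u v huv) ⟨i, hip⟩ ⟨k, hkp⟩
        (by simp [Fintype.card_subtype_compl, hn])
      have hcross := adjugate_cross_eq A p (hP p hp).det_pos.ne' ⟨i, hip⟩ ⟨k, hkp⟩
      have hpos := mul_pos hdet hsub
      simp only [Function.Embedding.coe_subtype] at hpos
      rw [← sub_pos]
      calc (0 : ℝ) < _ := hpos
        _ = σ i * σ k * (A.adjugate i k * A.adjugate p p - A.adjugate i p * A.adjugate p k) *
            (σ p * σ p) := by
          rw [hcross, hσσ]
          ring
        _ = _ := by ring

/-- Equation (2.1): under the hypotheses of the main theorem, every entry of the adjugate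
`ã` of `A` satisfies `sign(ã_{i,j}) = σ_i σ_j` (a statement that is invariant under
replacing `σ` by `-σ`); equivalently `D ã D` is entrywise positive for `D = diag σ`. -/
theorem ttp_adjugate_signs {n : ℕ} (T : SimpleGraph (Fin n)) (hT : T.IsTree)
    (A : Matrix (Fin n) (Fin n) ℝ) (hTTP : IsTTP T A) (hdet : 0 < A.det)
    (hP : ∀ p : Fin n, Pendant T p → IsPMatrix (deleteVertex A p))
    (σ : Fin n → ℝ) (hσ : IsSigning T σ) :
    ∀ i j : Fin n, 0 < σ i * A.adjugate i j * σ j := by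
  exact adjugate_signs hT hTTP hdet hP hσ.1 hσ.2
end

section
/- Let T be a tree on vertices 1,…,n and let A be an n×n real T-TP matrix such that det A > 0 and, for every pendant vertex q of T, the principal submatrix of A obtained by deleting row q and column q is a P-matrix. Let σ : {1,…,n} → {+1,−1} be a sign function with σ_u = −σ_v for every edge {u,v} of T, normalized so that the diagonal entries of the adjugate ã of A are positive. Suppose i and j are two non-pendant vertices of T for which there exists a pendant vertex p of T with either i < p and j < p, or p < i and p < j (as labels). Then sign(ã_{i,j}) = σ_i · σ_j. -/
open Matrix

/-- If every Schur complement of `b` at a pivot `p` or `q` is entrywise positive, positivity of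
`b q p` propagates along the column of `p`. -/
lemma pos_of_schur_of_pos {V : Type*} {b : V → V → ℝ} {i p q : V} (hp : 0 < b p p)
    (hq : 0 < b q q) (hip : i ≠ p) (hiq : i ≠ q) (hpq : p ≠ q)
    (hp' : ∀ i j, i ≠ p → j ≠ p → b i p * b p j < b i j * b p p)
    (hq' : ∀ i j, i ≠ q → j ≠ q → b i q * b q j < b i j * b q q)
    (hqp : 0 < b q p) : 0 < b i p := by
  by_contra! hle
  have h1 := hq' i p hiq hpq
  have h2 := hp' i q hip hpq.symm
  have h3 := hp' q q hpq.symm hpq.symm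
  have hiq' : b i q < 0 := by
    by_contra! h0
    nlinarith [mul_nonneg h0 hqp.le, mul_nonneg (neg_nonneg.2 hle) hq.le]
  have h4 : b i p * (b p q * b q p) < b i q * b p p * b q p := by
    nlinarith [mul_lt_mul_of_pos_right h2 hqp]
  have h5 : b i q * b q p * b p p < b i p * b q q * b p p := mul_lt_mul_of_pos_right h1 hp
  nlinarith [mul_nonneg (neg_nonneg.2 hle) (sub_nonneg.2 h3.le)]

/-- If the Schur complements of `b` at three distinct positive diagonal pivots are entrywise
positive, then `b` is entrywise positive. -/
lemma pos_of_schur {V : Type*} {b : V → V → ℝ} {L : Set V}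
    (hL : ∀ p q, ∃ r ∈ L, r ≠ p ∧ r ≠ q) (hd : ∀ p ∈ L, 0 < b p p)
    (hs : ∀ p ∈ L, ∀ i j, i ≠ p → j ≠ p → b i p * b p j < b i j * b p p) (i j : V) :
    0 < b i j := by
  have hLL : ∀ p ∈ L, ∀ r ∈ L, r ≠ p → 0 < b r p := by
    intro p hp r hr hrp
    obtain ⟨q, hq, hqp, hqr⟩ := hL p r
    by_contra! hle
    have h := hs q hq r p hqr.symm hqp.symm
    have hneg : b r q * b q p < 0 := by nlinarith [hd q hq]
    rcases mul_neg_iff.1 hneg with ⟨h1, -⟩ | ⟨-, h1⟩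
    · have := pos_of_schur_of_pos (b := fun x y => b y x) (i := p) (p := r) (q := q)
        (hd r hr) (hd q hq) hrp.symm hqp.symm hqr.symm
        (fun i j hi hj => by rw [mul_comm]; exact hs r hr j i hj hi)
        (fun i j hi hj => by rw [mul_comm]; exact hs q hq j i hj hi) h1
      exact hle.not_gt this
    · obtain h1 | h1 := lt_or_ge 0 (b q p)
      · exact hle.not_gt (pos_of_schur_of_pos (hd p hp) (hd q hq) hrp hqr.symm hqp.symm
          (hs p hp) (hs q hq) h1)
      · nlinarith
  have hcol : ∀ p ∈ L, ∀ i, 0 < b i p := by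
    intro p hp i
    rcases eq_or_ne i p with rfl | hip
    · exact hd i hp
    obtain ⟨q, hq, hqp, hqi⟩ := hL p i
    exact pos_of_schur_of_pos (hd p hp) (hd q hq) hip hqi.symm hqp.symm (hs p hp) (hs q hq)
      (hLL p hp q hq hqp)
  have hrow : ∀ p ∈ L, ∀ i, 0 < b p i := by
    intro p hp i
    rcases eq_or_ne i p with rfl | hip
    · exact hd i hp
    obtain ⟨q, hq, hqp, hqi⟩ := hL p i
    exact pos_of_schur_of_pos (b := fun x y => b y x) (hd p hp) (hd q hq) hip hqi.symm hqp.symm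
      (fun i j hi hj => by rw [mul_comm]; exact hs p hp j i hj hi)
      (fun i j hi hj => by rw [mul_comm]; exact hs q hq j i hj hi)
      (hLL q hq p hp hqp.symm)
  obtain ⟨p, hp, hpi, hpj⟩ := hL i j
  have := hs p hp i j hpi.symm hpj.symm
  exact pos_of_mul_pos_left ((mul_pos (hcol p hp i) (hrow p hp j)).trans this) (hd p hp).le

/-- A diagonal entry of the inverse is a quotient of principal minors. -/
lemma inv_apply_self_eq_div {V : Type*} [Fintype V] [DecidableEq V] (A : Matrix V V ℝ) (p : V) :
    A⁻¹ p p = (A.submatrix (Subtype.val : ({p}ᶜ : Set V) → V) Subtype.val).det / A.det := by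
  rw [inv_def, Matrix.smul_apply, Ring.inverse_eq_inv', smul_eq_mul, adjugate_apply,
    twoBlockTriangular_det' (A.updateRow p (Pi.single p 1)) (fun i => i = p), inv_mul_eq_div]
  · congr 1
    have h1 : (toSquareBlockProp (A.updateRow p (Pi.single p 1)) fun i => i = p).det = 1 := by
      rw [det_unique]
      simp [toSquareBlockProp, (default : {i // i = p}).2]
    refine (congrArg₂ (· * ·) (by convert h1) ?_).trans (one_mul _)
    let e : ({p}ᶜ : Set V) ≃ {i // ¬ i = p} := Equiv.refl _
    rw [← det_submatrix_equiv_self e]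
    congr 1
    ext i j
    exact congrFun (updateRow_ne i.2) _
  · rintro i rfl j hj
    simp [hj]

/-- The inverse of the submatrix obtained by deleting the row and the column of `p` is the Schur
complement in `A⁻¹` of the entry at `p`. -/
lemma inv_submatrix_compl_singleton {V : Type*} [Fintype V] [DecidableEq V] (A : Matrix V V ℝ)
    (hA : A.det ≠ 0) (p : V) (hp : A⁻¹ p p ≠ 0) :
    (A.submatrix (Subtype.val : ({p}ᶜ : Set V) → V) Subtype.val)⁻¹ =
      of fun i j : ({p}ᶜ : Set V) => A⁻¹ i j - A⁻¹ i p * A⁻¹ p j / A⁻¹ p p := by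
  apply inv_eq_right_inv
  ext i k
  have hmul : ∀ k, ∑ j : ({p}ᶜ : Set V), A i j * A⁻¹ j k = (1 : Matrix V V ℝ) i k -
      A i p * A⁻¹ p k := by
    intro k
    rw [← mul_nonsing_inv A hA.isUnit, mul_apply,
      Fintype.sum_eq_add_sum_subtype_ne (fun j => A i j * A⁻¹ j k) p, add_sub_cancel_left]
    rfl
  have hexp : ∀ j : ({p}ᶜ : Set V), A i j * (A⁻¹ j k - A⁻¹ j p * A⁻¹ p k / A⁻¹ p p) =
      A i j * A⁻¹ j k - A i j * A⁻¹ j p * (A⁻¹ p k / A⁻¹ p p) := fun j => by ring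
  have hip : (i : V) ≠ p := i.2
  simp only [mul_apply, submatrix_apply, of_apply, hexp, Finset.sum_sub_distrib,
    ← Finset.sum_mul, hmul, one_apply_ne hip, one_apply, Subtype.ext_iff]
  field_simp
  ring

/-- In a finite tree, either some path visits all vertices, or there are at least three
vertices of degree one. -/
lemma exists_hamiltonian_path_or_leaf {V : Type*} [Fintype V] [DecidableEq V]
    {T : SimpleGraph V} (hT : T.IsTree) :
    (∃ (u v : V) (w : T.Walk u v), w.IsPath ∧ ∀ x, x ∈ w.support) ∨
      ∀ p q : V, ∃ r, (∃! u, T.Adj r u) ∧ r ≠ p ∧ r ≠ q := by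
  classical
  by_contra! ⟨hw, p, q, hpq⟩
  have : Nonempty V := hT.connected.nonempty
  have : Nontrivial V := by
    by_contra hV
    rw [not_nontrivial_iff_subsingleton] at hV
    obtain ⟨x, hx⟩ := hw p p .nil .nil
    exact hx (by simp [Subsingleton.elim x p])
  have hsum : ∑ x, T.degree x + 2 = ∑ x : V, 2 := by
    have := hT.card_edgeFinset
    simp [T.sum_degrees_eq_twice_card_edges, ← this]
    ring
  have hpos : ∀ x, 1 ≤ T.degree x := fun x =>
    hT.connected.preconnected.degree_pos_of_nontrivial x
  have hsum' : ∑ x : V, 2 = ∑ x, (T.degree x + ((if x = p then 1 else 0) +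
      if x = q then 1 else 0)) := by
    rw [Finset.sum_add_distrib, Finset.sum_add_distrib, ← hsum]
    simp
  have hle : ∀ x ∈ Finset.univ, 2 ≤ T.degree x + ((if x = p then 1 else 0) +
      if x = q then 1 else 0) := by
    intro x _
    have h1 := hpos x
    have h2 : T.degree x = 1 → x ≠ p → x = q := fun h =>
      hpq x (SimpleGraph.degree_eq_one_iff_existsUnique_adj.1 h)
    grind
  have hdeg := (Finset.sum_eq_sum_iff_of_le hle).1 hsum'
  have hne : p ≠ q := by
    rintro rfl
    have := hdeg p (Finset.mem_univ p)
    have := hpos p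
    simp at *
    lia
  obtain ⟨w, hwp⟩ := hT.connected.exists_isPath p q
  obtain ⟨x, hx⟩ := hw p q w hwp
  have hclosed : ∀ y z, y ∈ w.support → T.Adj y z → z ∈ w.support := by
    intro y z hy hyz
    obtain ⟨k, rfl, hk⟩ := SimpleGraph.Walk.mem_support_iff_exists_getVert.1 hy
    have hd := hdeg (w.getVert k) (Finset.mem_univ _)
    have hlen : w.length ≠ 0 := fun h => hne (SimpleGraph.Walk.eq_of_length_eq_zero h)
    have hinj : ∀ a ≤ w.length, ∀ b ≤ w.length, w.getVert a = w.getVert b → a = b :=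
      fun a ha b hb h => hwp.getVert_injOn ha hb h
    by_cases hend : k = 0 ∨ k = w.length
    · have h1 : T.degree (w.getVert k) = 1 := by
        rcases hend with rfl | rfl <;> simp [hne, hne.symm] at hd ⊢ <;> lia
      obtain ⟨t, -, ht⟩ := SimpleGraph.degree_eq_one_iff_existsUnique_adj.1 h1
      rw [ht z hyz]
      rcases hend with rfl | rfl
      · rw [← ht _ (w.adj_getVert_succ (i := 0) (by lia))]
        exact w.getVert_mem_support _
      · have := w.adj_getVert_succ (i := w.length - 1) (by lia)
        rw [Nat.sub_add_cancel (by lia)] at this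
        rw [← ht _ this.symm]
        exact w.getVert_mem_support _
    · push Not at hend
      have h0 : w.getVert k ≠ p := fun h => hend.1 (hinj k hk 0 (by lia) (by simpa using h))
      have h1 : w.getVert k ≠ q := fun h =>
        hend.2 (hinj k hk _ le_rfl (by simpa using h))
      have hprev := w.adj_getVert_succ (i := k - 1) (by lia)
      rw [Nat.sub_add_cancel (by lia)] at hprev
      have hnext := w.adj_getVert_succ (i := k) (by lia)
      have hpn : w.getVert (k - 1) ≠ w.getVert (k + 1) := fun h => by
        have := hinj _ (by lia) _ (by lia) h
        lia
      have hsub : {w.getVert (k - 1), w.getVert (k + 1)} ⊆ T.neighborFinset (w.getVert k) := by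
        simp [Finset.insert_subset_iff, hprev.symm, hnext]
      have heq := Finset.eq_of_subset_of_card_le hsub (by
        rw [SimpleGraph.card_neighborFinset_eq_degree, Finset.card_pair hpn]
        simp [h0, h1] at hd
        lia)
      have hz : z ∈ T.neighborFinset (w.getVert k) := by simpa using hyz
      rw [← heq, Finset.mem_insert, Finset.mem_singleton] at hz
      rcases hz with rfl | rfl <;> exact w.getVert_mem_support _
  obtain ⟨w'⟩ := hT.connected.preconnected p x
  have hwalk : ∀ {a b : V} (c : T.Walk a b), a ∈ w.support → b ∈ w.support := by
    intro a b c
    induction c with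
    | nil => exact id
    | cons h _ ih => exact fun ha => ih (hclosed _ _ ha h)
  exact hx (hwalk w' w.start_mem_support)

/-- Inverses of matrices that are totally positive along a path through all indices have
alternating signs. -/
lemma signed_inv_pos_of_path {V : Type*} [Fintype V] [DecidableEq V] {T : SimpleGraph V}
    {A : Matrix V V ℝ} {u v : V} (w : T.Walk u v) (hw : w.IsPath) (hall : ∀ x, x ∈ w.support)
    (hTTP : ∀ (k : ℕ) (f g : Fin k → ℕ), StrictMono f → StrictMono g →
      (∀ s, f s ≤ w.length) → (∀ s, g s ≤ w.length) →
      0 < (of fun s t => A (w.getVert (f s)) (w.getVert (g t))).det)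
    (hdet : 0 < A.det) {σ : V → ℝ} (hσ : ∀ i, σ i = 1 ∨ σ i = -1)
    (hσ' : ∀ u v, T.Adj u v → σ u = -σ v) (i j : V) : 0 < σ i * σ j * A⁻¹ i j := by
  let e : Fin (w.length + 1) ≃ V := Equiv.ofBijective (fun s => w.getVert s)
    ⟨fun a b h => Fin.ext (hw.getVert_injOn (Nat.le_of_lt_succ a.2) (Nat.le_of_lt_succ b.2) h),
      fun x => by
        obtain ⟨k, hk, hkl⟩ := SimpleGraph.Walk.mem_support_iff_exists_getVert.1 (hall x)
        exact ⟨⟨k, Nat.lt_succ_of_le hkl⟩, hk⟩⟩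
  have hsgn : ∀ k ≤ w.length, σ (w.getVert k) = (-1) ^ k * σ u := by
    intro k hk
    induction k with
    | zero => simp
    | succ k ih =>
      have := hσ' _ _ (w.adj_getVert_succ (i := k) (by lia))
      rw [ih (by lia)] at this
      rw [pow_succ]
      linarith
  obtain ⟨s, rfl⟩ := e.surjective i
  obtain ⟨t, rfl⟩ := e.surjective j
  have hadj : A.adjugate (e s) (e t) = (-1) ^ (t + s : ℕ) *
      ((A.submatrix e e).submatrix t.succAbove s.succAbove).det := by
    rw [← adjugate_fin_succ_eq_det_submatrix, adjugate_submatrix_equiv_self, submatrix_apply]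
  have hminor : 0 < ((A.submatrix e e).submatrix t.succAbove s.succAbove).det :=
    hTTP _ (fun a => t.succAbove a) (fun a => s.succAbove a)
      (fun _ _ h => Fin.strictMono_succAbove t h) (fun _ _ h => Fin.strictMono_succAbove s h)
      (fun a => Nat.le_of_lt_succ (t.succAbove a).2) (fun a => Nat.le_of_lt_succ (s.succAbove a).2)
  have hs : σ (e s) = (-1) ^ (s : ℕ) * σ u := hsgn s (Nat.le_of_lt_succ s.2)
  have ht : σ (e t) = (-1) ^ (t : ℕ) * σ u := hsgn t (Nat.le_of_lt_succ t.2)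
  have hu : σ u * σ u = 1 := by rcases hσ u with h | h <;> simp [h]
  have hsq : ∀ k : ℕ, ((-1 : ℝ) ^ k) * (-1) ^ k = 1 := fun k => by
    rw [← mul_pow]; simp
  rw [inv_def, Matrix.smul_apply, Ring.inverse_eq_inv', smul_eq_mul, hadj, hs, ht, pow_add]
  calc 0 < A.det⁻¹ * ((A.submatrix e e).submatrix t.succAbove s.succAbove).det :=
        mul_pos (inv_pos.2 hdet) hminor
    _ = (((-1) ^ (s : ℕ) * (-1) ^ (s : ℕ)) * ((-1) ^ (t : ℕ) * (-1) ^ (t : ℕ)) * (σ u * σ u)) *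
        (A.det⁻¹ * ((A.submatrix e e).submatrix t.succAbove s.succAbove).det) := by
      rw [hsq, hsq, hu, one_mul, one_mul, one_mul]
    _ = _ := by ring

/-- The inverse of a matrix that is totally positive along all paths of a tree, has positive
determinant, and has positive principal minors away from any vertex of degree one, is signed
according to the tree. -/
theorem signed_inv_pos_of_tree {V : Type*} [Fintype V] [DecidableEq V] (T : SimpleGraph V)
    (hT : T.IsTree)
    (A : Matrix V V ℝ)
    (hTTP : ∀ (u v : V) (w : T.Walk u v), w.IsPath → ∀ (k : ℕ) (f g : Fin k → ℕ),
      StrictMono f → StrictMono g → (∀ s, f s ≤ w.length) → (∀ s, g s ≤ w.length) →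
      0 < (of fun s t => A (w.getVert (f s)) (w.getVert (g t))).det)
    (hdet : 0 < A.det)
    (hP : ∀ q : V, (∃! u, T.Adj q u) → ∀ (k : ℕ) (f : Fin k → V), Function.Injective f →
      q ∉ Set.range f → 0 < (A.submatrix f f).det)
    (σ : V → ℝ) (hσ : ∀ i, σ i = 1 ∨ σ i = -1) (hσ' : ∀ u v, T.Adj u v → σ u = -σ v)
    (i j : V) : 0 < σ i * σ j * A⁻¹ i j := by
  classical
  induction hN : Fintype.card V generalizing V with
  | zero => exact ((Fintype.card_eq_zero_iff.1 hN).false i).elim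
  | succ N ih =>
  obtain ⟨u, v, w, hw, hall⟩ | hL := exists_hamiltonian_path_or_leaf hT
  · exact signed_inv_pos_of_path w hw hall (hTTP u v w hw) hdet hσ hσ' i j
  have hdel : ∀ p, (∃! u, T.Adj p u) →
      0 < (A.submatrix (Subtype.val : ({p}ᶜ : Set V) → V) Subtype.val).det := by
    intro p hp
    rw [← det_submatrix_equiv_self (Fintype.equivFin ({p}ᶜ : Set V)).symm, submatrix_submatrix]
    refine hP p hp _ _ (Subtype.val_injective.comp (Equiv.injective _)) ?_
    rintro ⟨s, hs⟩
    exact ((Fintype.equivFin ({p}ᶜ : Set V)).symm s).2 hs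
  have hpp : ∀ p, (∃! u, T.Adj p u) → 0 < A⁻¹ p p := fun p hp => by
    rw [inv_apply_self_eq_div]
    exact div_pos (hdel p hp) hdet
  have hsq : ∀ p, σ p * σ p = 1 := fun p => by rcases hσ p with h | h <;> simp [h]
  refine pos_of_schur (b := fun i j => σ i * σ j * A⁻¹ i j) (L := {p | ∃! u, T.Adj p u}) hL
    (fun p hp => ?_) (fun p hp i j hi hj => ?_) i j
  · simpa [hsq] using hpp p hp
  have hconn := hT.connected.induce_compl_singleton_of_degree_eq_one
    (SimpleGraph.degree_eq_one_iff_existsUnique_adj.2 hp)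
  have key := ih (V := ({p}ᶜ : Set V)) (T.induce {p}ᶜ) ⟨hconn, hT.isAcyclic.induce _⟩
    (A.submatrix Subtype.val Subtype.val)
    (fun u v w hw k f g hf hg hfl hgl => by
      let w' := w.map (SimpleGraph.Embedding.induce ({p}ᶜ : Set V)).toHom
      have hv : ∀ n, w'.getVert n = w.getVert n := SimpleGraph.Walk.getVert_map _ w
      have h := hTTP _ _ w' (hw.map Subtype.val_injective) k f g hf hg
        (fun s => (hfl s).trans_eq (SimpleGraph.Walk.length_map _ _).symm)
        (fun s => (hgl s).trans_eq (SimpleGraph.Walk.length_map _ _).symm)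
      simp only [hv] at h
      exact h)
    (hdel p hp)
    (fun q _ k f hf hq => by
      rw [submatrix_submatrix]
      refine hP p hp k _ (Subtype.val_injective.comp hf) ?_
      rintro ⟨s, hs⟩
      exact (f s).2 hs)
    (fun x => σ x) (fun x => hσ x) (fun x y hxy => hσ' x y hxy) ⟨i, hi⟩ ⟨j, hj⟩
    (by rw [Fintype.card_compl_set, hN, Set.card_singleton, Nat.add_sub_cancel])
  rw [inv_submatrix_compl_singleton A hdet.ne' p (hpp p hp).ne', of_apply] at key
  have h := mul_pos key (hpp p hp)
  have h' : σ i * σ j * (A⁻¹ i j - A⁻¹ i p * A⁻¹ p j / A⁻¹ p p) * A⁻¹ p p =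
      σ i * σ j * A⁻¹ i j * A⁻¹ p p - σ i * σ j * (A⁻¹ i p * A⁻¹ p j) := by
    have := (hpp p hp).ne'
    field_simp
  rw [h'] at h
  linear_combination h + (σ i * σ j * A⁻¹ i p * A⁻¹ p j - σ i * σ j * A⁻¹ i j * A⁻¹ p p) * hsq p

/-- Lemma 2.7: if `i` and `j` are non-pendant vertices such that some pendant vertex `p`
has a label larger than both, or smaller than both, then `sign(ã_{i,j}) = σ_i σ_j`. -/
theorem ttp_adjugate_sign_nonpendant_sameside {n : ℕ} (T : SimpleGraph (Fin n))
    (hT : T.IsTree)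
    (A : Matrix (Fin n) (Fin n) ℝ) (hTTP : IsTTP T A) (hdet : 0 < A.det)
    (hP : ∀ q : Fin n, Pendant T q → IsPMatrix (deleteVertex A q))
    (σ : Fin n → ℝ) (hσ : IsSigning T σ)
    (i j : Fin n) (hi : ¬ Pendant T i) (hj : ¬ Pendant T j)
    (hp : ∃ p : Fin n, Pendant T p ∧ ((i < p ∧ j < p) ∨ (p < i ∧ p < j))) :
    0 < σ i * σ j * A.adjugate i j := by
  have h := signed_inv_pos_of_tree T hT A (fun u v w hw k f g hf hg hfl hgl => ?_) hdet
    (fun q hq k f hf hqf => ?_) σ hσ.1 hσ.2 i j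
  · have hB : A.adjugate i j = A.det * A⁻¹ i j := by
      rw [inv_def, Matrix.smul_apply, Ring.inverse_eq_inv', smul_eq_mul, mul_inv_cancel_left₀ hdet.ne']
    rw [hB, mul_left_comm]
    exact mul_pos hdet h
  · have := hTTP u v w hw k (fun s => ⟨f s, by have := hfl s; simp; lia⟩)
      (fun s => ⟨g s, by have := hgl s; simp; lia⟩) (fun _ _ h => hf h) (fun _ _ h => hg h)
    simpa [submatrix, SimpleGraph.Walk.support_getElem_eq_getVert] using this
  · let f' : Fin k → {i : Fin n // i ≠ q} := fun s => ⟨f s, fun h => hqf ⟨s, h⟩⟩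
    have hf' : Function.Injective f' := fun a b h => hf (congrArg Subtype.val h)
    let e : Fin k ≃ (Finset.univ.image f' : Finset {i : Fin n // i ≠ q}) :=
      Equiv.ofBijective (fun s => ⟨f' s, Finset.mem_image_of_mem _ (Finset.mem_univ s)⟩)
        ⟨fun a b h => hf' (congrArg Subtype.val h), fun ⟨x, hx⟩ => by
          obtain ⟨s, -, hs⟩ := Finset.mem_image.1 hx
          exact ⟨s, Subtype.ext hs⟩⟩
    have := hP q hq (Finset.univ.image f')
    rw [← det_submatrix_equiv_self e] at this
    exact this
end

section
/- Let A be an n×n real matrix and let α = (a_1,…,a_k) and β = (b_1,…,b_k) be ordered index lists of the same size k ≥ 2 with entries in {1,…,n}. Write α' for α without its last index, 'α for α without its first index, and 'α' for α without both its first and last indices (and similarly for β). Then, writing A[γ;δ] for the determinant of the submatrix of A whose rows are taken in the order given by γ and whose columns in the order given by δ, the following (Sylvester / Desnanot–Jacobi) identity holds: A[α;β] · A['α';'β'] = A[α';β'] · A['α;'β] − A[α';β] · A['α;β']. -/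
open Matrix

namespace Matrix

variable {R : Type*} [CommRing R] {m : ℕ}

/-- A square matrix whose first and last columns are `d` times the first and last standard basis
vectors has determinant `d ^ 2` times that of its central minor. -/
theorem det_eq_sq_mul_det_of_first_last_col (N : Matrix (Fin (m + 2)) (Fin (m + 2)) R) (d : R)
    (h0 : ∀ i, N i 0 = if i = 0 then d else 0)
    (hl : ∀ i, N i (Fin.last _) = if i = Fin.last _ then d else 0) :
    N.det = d ^ 2 * (N.submatrix (fun t : Fin m => t.castSucc.succ)
      (fun t : Fin m => t.castSucc.succ)).det := by
  rw [det_succ_column_zero, Fin.sum_univ_succ, Finset.sum_eq_zero, add_zero,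
    det_succ_column _ (Fin.last m), Fin.sum_univ_castSucc, Finset.sum_eq_zero, zero_add]
  · have hll : N (Fin.last m).succ (Fin.last m).succ = d := by simpa using hl (Fin.last _)
    simp [h0, hll, -Fin.succ_last, Function.comp_def, ← two_mul, pow_mul]
    ring
  · intro i _
    have : i.castSucc.succ ≠ Fin.last (m + 1) := by
      rw [← Fin.succ_last, Ne, Fin.succ_inj]
      exact i.castSucc_ne_last
    simp [hl, this]
  · intro i _
    simp [h0]

/-- The Desnanot–Jacobi identity for the adjugate, before cancelling a factor `M.det`. -/
theorem det_mul_adjugate_minor (M : Matrix (Fin (m + 2)) (Fin (m + 2)) R) :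
    M.det * (M.adjugate 0 0 * M.adjugate (Fin.last _) (Fin.last _)
        - M.adjugate 0 (Fin.last _) * M.adjugate (Fin.last _) 0)
      = M.det ^ 2 * (M.submatrix (fun t : Fin m => t.castSucc.succ)
          (fun t : Fin m => t.castSucc.succ)).det := by
  let p : Fin 2 → Fin (m + 2) := ![0, Fin.last _]
  have hp0 : p 0 = 0 := rfl
  have hp1 : p 1 = Fin.last _ := rfl
  let V : Matrix (Fin 2) (Fin (m + 2)) R := (1 : Matrix _ _ R).submatrix p id
  let U : Matrix (Fin (m + 2)) (Fin 2) R := (M.adjugate - 1).submatrix id p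
  have hV : V * U = (M.adjugate - 1).submatrix p p := by
    rw [← submatrix_mul _ _ p id p Function.bijective_id, one_mul]
  have hU : M * U = (M.det • (1 : Matrix _ _ R) - M).submatrix id p := by
    have := submatrix_mul M (M.adjugate - 1) id id p Function.bijective_id
    rw [submatrix_id_id] at this
    rw [← this, mul_sub, mul_adjugate, mul_one]
  have hdet : (1 + U * V).det = M.adjugate 0 0 * M.adjugate (Fin.last _) (Fin.last _)
      - M.adjugate 0 (Fin.last _) * M.adjugate (Fin.last _) 0 := by
    rw [det_one_add_mul_comm, hV, det_fin_two]
    simp only [add_apply, submatrix_apply, sub_apply]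
    simp [hp0, hp1, Fin.last_pos.ne]
  have hN : ∀ i j, (M * (1 + U * V) : Matrix (Fin (m + 2)) (Fin (m + 2)) R) i j = M i j
      + (((if i = 0 then M.det else 0) - M i 0) * (if 0 = j then 1 else 0)
      + ((if i = Fin.last _ then M.det else 0) - M i (Fin.last _))
        * (if Fin.last _ = j then 1 else 0)) := by
    intro i j
    rw [mul_add, mul_one, ← Matrix.mul_assoc, hU, add_apply, mul_apply, Fin.sum_univ_two]
    simp [hp0, hp1, V, one_apply]
  rw [← hdet, ← det_mul, det_eq_sq_mul_det_of_first_last_col _ M.det]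
  · congr 2
    ext i j
    have hl : Fin.last (m + 1) ≠ j.castSucc.succ := by
      rw [← Fin.succ_last, Ne, Fin.succ_inj]
      exact j.castSucc_ne_last.symm
    have h0 : 0 ≠ j.castSucc.succ := (Fin.succ_ne_zero _).symm
    simp only [submatrix_apply, hN, if_neg hl, if_neg h0, mul_zero, add_zero]
  · intro i
    rw [hN, if_pos rfl, if_neg Fin.last_pos.ne']
    ring
  · intro i
    rw [hN, if_neg Fin.last_pos.ne, if_pos rfl]
    ring

/-- The Desnanot–Jacobi identity for the adjugate. -/
theorem det_mul_det_eq_adjugate_minor (M : Matrix (Fin (m + 2)) (Fin (m + 2)) R) :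
    M.det * (M.submatrix (fun t : Fin m => t.castSucc.succ)
          (fun t : Fin m => t.castSucc.succ)).det
      = M.adjugate 0 0 * M.adjugate (Fin.last _) (Fin.last _)
        - M.adjugate 0 (Fin.last _) * M.adjugate (Fin.last _) 0 := by
  have generic := mul_left_cancel₀ (det_mvPolynomialX_ne_zero (Fin (m + 2)) ℤ)
    ((det_mul_adjugate_minor (mvPolynomialX (Fin (m + 2)) (Fin (m + 2)) ℤ)).trans
      (by rw [pow_two, mul_assoc]))
  let f := MvPolynomial.eval₂Hom (Int.castRingHom R) fun p : Fin (m + 2) × Fin (m + 2) => M p.1 p.2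
  have hf : f.mapMatrix (mvPolynomialX _ _ ℤ) = M := mvPolynomialX_map_eval₂ _ M
  have hadj : ∀ i j, f ((mvPolynomialX (Fin (m + 2)) (Fin (m + 2)) ℤ).adjugate i j)
      = M.adjugate i j := by
    intro i j
    rw [← hf, ← RingHom.map_adjugate]
    rfl
  have h := congrArg f generic
  simp only [map_mul, map_sub, hadj, RingHom.map_det] at h
  rw [h, hf, ← hf]
  rfl

end Matrix

/-- Sylvester's determinantal identity (Desnanot–Jacobi), multiplicative form, for ordered
index lists `α, β` of length `k = m + 2 ≥ 2`:
`A[α;β] · A['α';'β'] = A[α';β'] · A['α;'β] − A[α';'β] · A['α;β']`,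
where `α'` drops the last index, `'α` drops the first index, and `'α'` drops both
(for `k = 2` the empty determinant `A['α';'β']` is `1`). -/
theorem sylvester_identity {n m : ℕ} (A : Matrix (Fin n) (Fin n) ℝ)
    (α β : Fin (m + 2) → Fin n) :
    (A.submatrix α β).det
        * (A.submatrix (fun t : Fin m => α t.castSucc.succ)
            (fun t : Fin m => β t.castSucc.succ)).det
      = (A.submatrix (fun t : Fin (m + 1) => α t.castSucc)
            (fun t : Fin (m + 1) => β t.castSucc)).det
          * (A.submatrix (fun t : Fin (m + 1) => α t.succ)
              (fun t : Fin (m + 1) => β t.succ)).det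
        - (A.submatrix (fun t : Fin (m + 1) => α t.castSucc)
            (fun t : Fin (m + 1) => β t.succ)).det
          * (A.submatrix (fun t : Fin (m + 1) => α t.succ)
              (fun t : Fin (m + 1) => β t.castSucc)).det := by
  have h := det_mul_det_eq_adjugate_minor (A.submatrix α β)
  simp only [adjugate_fin_succ_eq_det_submatrix, submatrix_submatrix, Fin.succAbove_last,
    Fin.succAbove_zero, Function.comp_def] at h
  refine h.trans ?_
  have hs : ((-1 : ℝ) ^ (m + 1)) * (-1) ^ (m + 1) = 1 := by
    rw [← mul_pow]; simp
  simp only [Fin.val_zero, Fin.val_last, add_zero, zero_add, pow_add _ (m + 1) (m + 1), hs,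
    pow_zero, one_mul]
  linear_combination (-(A.submatrix (fun t : Fin (m + 1) => α t.castSucc)
            (fun t : Fin (m + 1) => β t.succ)).det
          * (A.submatrix (fun t : Fin (m + 1) => α t.succ)
              (fun t : Fin (m + 1) => β t.castSucc)).det) * hs
end
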